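/- Let H be an abelian subgroup of Sym_n and K a field. Then the Jacobson radical of the monoid algebra K[S_n(H)] is zero. -/

import Mathlib

/-- The word `a_{σ(1)} ⋯ a_{σ(n)}` in the free monoid on `n` generators. -/
def permWord {n : ℕ} (σ : Equiv.Perm (Fin n)) : FreeMonoid (Fin n) :=
  FreeMonoid.ofList (List.ofFn fun i => σ i)

/-- The defining relations of `S_n(H)`. -/
def snRel (n : ℕ) (H : Set (Equiv.Perm (Fin n)))
    (a b : FreeMonoid (Fin n)) : Prop :=
  ∃ σ ∈ H, a = permWord 1 ∧ b = permWord σ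

/-- The congruence generated by the relations of `S_n(H)`. -/
def snCon (n : ℕ) (H : Set (Equiv.Perm (Fin n))) : Con (FreeMonoid (Fin n)) :=
  conGen (snRel n H)

/-- The monoid `S_n(H)` presented by `a_1,…,a_n` with relations
`a_1⋯a_n = a_{σ(1)}⋯a_{σ(n)}` for `σ ∈ H`. -/
abbrev SnMonoid (n : ℕ) (H : Set (Equiv.Perm (Fin n))) : Type :=
  (snCon n H).Quotient

/-- The canonical projection `π : FM_n → S_n(H)`. -/
def snPi (n : ℕ) (H : Set (Equiv.Perm (Fin n))) :
    FreeMonoid (Fin n) →* SnMonoid n H :=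
  (snCon n H).mk'

/-- The generator `a_i` of `S_n(H)`. -/
def aGen (n : ℕ) (H : Set (Equiv.Perm (Fin n))) (i : Fin n) : SnMonoid n H :=
  snPi n H (FreeMonoid.of i)

/-- The element `z = a_1 a_2 ⋯ a_n` of `S_n(H)`. -/
def zElem (n : ℕ) (H : Set (Equiv.Perm (Fin n))) : SnMonoid n H :=
  snPi n H (permWord 1)

/-- A (two-sided) ideal-like subset `I` of a monoid is prime if for all `u, v ∉ I`
there is `s` with `u * s * v ∉ I`. -/
def MonoidIdeal.IsPrime {M : Type*} [Monoid M] (I : Set M) : Prop :=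
  ∀ u v : M, u ∉ I → v ∉ I → ∃ s : M, u * s * v ∉ I


namespace SnAux

theorem crit {K M : Type} [Field K] [Monoid M] (C : Finset M)
    (h : ∀ A B : Finset M, A.Nonempty → B.Nonempty → ∃ s ∈ A, ∃ c ∈ C, ∃ t ∈ B,
      (∀ s' ∈ A, ∀ c' ∈ C, ∀ t' ∈ B, s' * c' * t' = s * c * t → s' = s ∧ c' = c ∧ t' = t) ∧
      s * c * t ∉ A ∧ s * c * t ≠ 1) :
    (⊥ : Ideal (MonoidAlgebra K M)).jacobson = ⊥ := by
  classical
  rw [eq_bot_iff]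
  intro x hx
  rw [Ideal.mem_bot]
  by_contra hx0
  rw [Ideal.mem_jacobson_iff] at hx
  let r : MonoidAlgebra K M := ⟨Finsupp.indicator C (fun _ _ => 1)⟩
  have hrs : r.coeff.support ⊆ C := Finsupp.support_indicator_subset _ _
  have hr1 : ∀ c ∈ C, r.coeff c = 1 := fun c hc => by
    simp [r, Finsupp.indicator_of_mem hc]
  obtain ⟨y, hy⟩ := hx r
  rw [Ideal.mem_bot] at hy
  have hy0 : y ≠ 0 := by
    rintro rfl
    simp at hy
  obtain ⟨s, hs, c, hc, t, ht, hu, hA, h1⟩ := h y.coeff.support x.coeff.support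
    (by rw [Finsupp.support_nonempty_iff]; simpa using hy0)
    (by rw [Finsupp.support_nonempty_iff]; simpa using hx0)
  have e1 : (y * r).coeff (s * c) = y.coeff s * r.coeff c := by
    apply MonoidAlgebra.coeff_mul_mul_of_uniqueMul
    intro a b ha hb hab
    have := hu a ha b (hrs hb) t ht (by rw [hab])
    exact ⟨this.1, this.2.1⟩
  have e2 : (y * r * x).coeff (s * c * t) = (y * r).coeff (s * c) * x.coeff t := by
    apply MonoidAlgebra.coeff_mul_mul_of_uniqueMul
    intro a b ha hb hab
    have ha' := MonoidAlgebra.support_coeff_mul_subset y r ha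
    obtain ⟨s', hs', c', hc', rfl⟩ := Finset.mem_mul.1 ha'
    obtain ⟨h1, h2, h3⟩ := hu s' hs' c' (hrs hc') b hb hab
    subst h1 h2 h3
    exact ⟨rfl, rfl⟩
  have e3 := congrArg (fun q => q.coeff (s * c * t)) hy
  simp only [MonoidAlgebra.coeff_sub, MonoidAlgebra.coeff_add, Finsupp.sub_apply,
    Finsupp.add_apply, e2, e1, hr1 c hc, MonoidAlgebra.coeff_zero, Finsupp.zero_apply,
    Finsupp.notMem_support_iff.1 hA, MonoidAlgebra.one_def, MonoidAlgebra.coeff_single,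
    Finsupp.single_eq_of_ne h1] at e3
  rw [Finsupp.mem_support_iff] at hs ht
  simp [hs, ht] at e3

/-- The list of letters of the defining word of `σ`. -/
def wd {n : ℕ} (σ : Equiv.Perm (Fin n)) : List (Fin n) := List.ofFn fun i => σ i

@[simp] theorem wd_length {n : ℕ} (σ : Equiv.Perm (Fin n)) : (wd σ).length = n := by simp [wd]

theorem wd_nodup {n : ℕ} (σ : Equiv.Perm (Fin n)) : (wd σ).Nodup :=
  List.nodup_ofFn.2 σ.injective

theorem wd_get {n : ℕ} (σ : Equiv.Perm (Fin n)) (i : ℕ) (h : i < n) :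
    (wd σ)[i]? = some (σ ⟨i, h⟩) := by
  simp [wd, h]

theorem wd_inj {n : ℕ} {σ τ : Equiv.Perm (Fin n)} (h : wd σ = wd τ) : σ = τ := by
  ext i
  exact congrArg Fin.val (congrFun (List.ofFn_injective h) i)

/-- One rewriting step. -/
def Step {n : ℕ} (H : Subgroup (Equiv.Perm (Fin n))) (W W' : List (Fin n)) : Prop :=
  ∃ p q : List (Fin n), ∃ σ ∈ H, ∃ τ ∈ H, W = p ++ wd σ ++ q ∧ W' = p ++ wd τ ++ q

/-- Equivalence of words. -/
def Eqv {n : ℕ} (H : Subgroup (Equiv.Perm (Fin n))) (W W' : List (Fin n)) : Prop :=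
  Relation.ReflTransGen (Step H) W W'

section basic
variable {n : ℕ} {H : Subgroup (Equiv.Perm (Fin n))}

theorem Step.symm {W W' : List (Fin n)} (h : Step H W W') : Step H W' W := by
  obtain ⟨p, q, σ, hσ, τ, hτ, h1, h2⟩ := h
  exact ⟨p, q, τ, hτ, σ, hσ, h2, h1⟩

theorem Step.ctx {W W' : List (Fin n)} (a b : List (Fin n)) (h : Step H W W') :
    Step H (a ++ W ++ b) (a ++ W' ++ b) := by
  obtain ⟨p, q, σ, hσ, τ, hτ, rfl, rfl⟩ := h
  exact ⟨a ++ p, q ++ b, σ, hσ, τ, hτ, by simp, by simp⟩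

theorem Eqv.ctx {W W' : List (Fin n)} (a b : List (Fin n)) (h : Eqv H W W') :
    Eqv H (a ++ W ++ b) (a ++ W' ++ b) := by
  induction h with
  | refl => exact .refl
  | tail _ h ih => exact ih.tail (h.ctx a b)

theorem Eqv.symm {W W' : List (Fin n)} (h : Eqv H W W') : Eqv H W' W := by
  induction h with
  | refl => exact .refl
  | tail _ h ih => exact Relation.ReflTransGen.head h.symm ih

theorem Eqv.trans {W W' W'' : List (Fin n)} (h : Eqv H W W') (h' : Eqv H W' W'') : Eqv H W W'' :=
  Relation.ReflTransGen.trans h h'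

theorem Eqv.invar {P : List (Fin n) → Prop} (hP : ∀ W W', Step H W W' → P W → P W')
    {W W' : List (Fin n)} (h : Eqv H W W') (hW : P W) : P W' := by
  induction h with
  | refl => exact hW
  | tail _ h ih => exact hP _ _ h ih

theorem Eqv.length {W W' : List (Fin n)} (h : Eqv H W W') : W.length = W'.length := by
  refine Eqv.invar (P := fun V => W.length = V.length) ?_ h rfl
  rintro V V' ⟨p, q, σ, hσ, τ, hτ, rfl, rfl⟩ e
  simpa using e

variable (H) in
/-- The congruence of words. -/
def eqvCon : Con (FreeMonoid (Fin n)) where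
  r a b := Eqv H a.toList b.toList
  iseqv := ⟨fun _ => .refl, fun h => h.symm, fun h h' => h.trans h'⟩
  mul' := by
    intro a b c d h1 h2
    have e1 := h1.ctx [] c.toList
    have e2 := h2.ctx b.toList []
    simp only [List.nil_append, List.append_nil] at e1 e2
    exact e1.trans e2

variable (H) in
/-- The element of the monoid given by a word. -/
def pi (W : List (Fin n)) : SnMonoid n ↑H := snPi n ↑H (FreeMonoid.ofList W)

theorem pi_append (A B : List (Fin n)) : pi H (A ++ B) = pi H A * pi H B := by
  simp [pi]

theorem pi_nil : pi H [] = 1 := by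
  simp [pi]

theorem pi_surj (s : SnMonoid n ↑H) : ∃ W, pi H W = s := by
  obtain ⟨w, rfl⟩ := Con.mk'_surjective (c := snCon n ↑H) s
  exact ⟨w.toList, rfl⟩

theorem pi_wd (σ : Equiv.Perm (Fin n)) (hσ : σ ∈ H) : pi H (wd σ) = pi H (wd 1) := by
  symm
  exact (Con.eq _).2 (ConGen.Rel.of _ _ ⟨σ, hσ, rfl, rfl⟩)

theorem pi_eq_iff (W W' : List (Fin n)) : pi H W = pi H W' ↔ Eqv H W W' := by
  constructor
  · intro h
    have h' : snCon n ↑H (FreeMonoid.ofList W) (FreeMonoid.ofList W') := (Con.eq _).1 h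
    have hle : snCon n ↑H ≤ eqvCon H := by
      apply Con.conGen_le.2
      rintro a b ⟨σ, hσ, rfl, rfl⟩
      exact Relation.ReflTransGen.single ⟨[], [], 1, H.one_mem, σ, hσ, by simp [wd, permWord], by simp [wd, permWord]⟩
    exact hle h'
  · intro h
    refine Eqv.invar (P := fun V => pi H W = pi H V) ?_ h rfl
    rintro V V' ⟨p, q, σ, hσ, τ, hτ, rfl, rfl⟩ e
    rw [e]
    simp only [pi_append, pi_wd σ hσ, pi_wd τ hτ]

/-- A representing word. -/
noncomputable def rep (s : SnMonoid n ↑H) : List (Fin n) := (pi_surj s).choose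

theorem pi_rep (s : SnMonoid n ↑H) : pi H (rep s) = s := (pi_surj s).choose_spec

theorem rep_pi (W : List (Fin n)) : Eqv H (rep (pi H W)) W := (pi_eq_iff _ _).1 (pi_rep _)

end basic

theorem inv_self {α : Type*} (f : Equiv.Perm α) (x : α) : f⁻¹ (f x) = x := f.symm_apply_apply x

theorem splitR {α : Type*} {A r P Q : List α} (h : A ++ r = P ++ Q) (hl : r.length ≤ Q.length) :
    ∃ s, Q = s ++ r ∧ A = P ++ s := by
  rcases List.append_eq_append_iff.1 h with ⟨a, rfl, rfl⟩ | ⟨a, rfl, rfl⟩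
  · have : a = [] := by
      rw [← List.length_eq_zero_iff]; rw [List.length_append] at hl; omega
    subst this
    exact ⟨[], by simp, by simp⟩
  · exact ⟨a, rfl, rfl⟩

section ex
variable {n : ℕ} {H : Subgroup (Equiv.Perm (Fin n))}

/-- Shift by `d` is realised by an element of `H`. -/
def Good (H : Subgroup (Equiv.Perm (Fin n))) (d : ℕ) : Prop :=
  ∃ ρ ∈ H, ∀ a : ℕ, ∀ h : a + d < n, ρ ⟨a, by omega⟩ = ⟨a + d, h⟩

/-- The last `d` letters of a defining word. -/
def tl (d : ℕ) (τ : Equiv.Perm (Fin n)) : List (Fin n) := (wd τ).drop (n - d)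

theorem tl_length {d : ℕ} (hd : d ≤ n) (τ : Equiv.Perm (Fin n)) : (tl d τ).length = d := by
  simp [tl]; omega

theorem tl_get {d : ℕ} (τ : Equiv.Perm (Fin n)) (i : ℕ) (h : n - d + i < n) :
    (tl d τ)[i]? = some (τ ⟨n - d + i, h⟩) := by
  rw [tl, List.getElem?_drop, wd_get _ _ h]

inductive TL (H : Subgroup (Equiv.Perm (Fin n))) : List (Fin n) → Prop
  | nil : TL H []
  | cons (d : ℕ) (τ : Equiv.Perm (Fin n)) (B : List (Fin n)) (h0 : 0 < d) (hn : d < n)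
      (hg : Good H d) (hτ : τ ∈ H) (hB : TL H B) : TL H (tl d τ ++ B)

theorem win {X q s : List (Fin n)} {π τ : Equiv.Perm (Fin n)} {d e : ℕ} (hd : d ≤ n)
    (hs : s.length = e) (h : X ++ wd π = q ++ tl d τ ++ s) (a : ℕ) (ha : a + e < n)
    (hb : n ≤ a + e + d) : π ⟨a, by omega⟩ = τ ⟨a + e, ha⟩ := by
  have hl := congrArg List.length h
  simp only [List.length_append, wd_length, tl_length hd, hs] at hl
  have h1 := congrArg (fun l => l[X.length + a]?) h
  beta_reduce at h1
  rw [List.getElem?_append_right (by omega), List.getElem?_append_left (by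
    rw [List.length_append, tl_length hd]; omega), List.getElem?_append_right (by omega),
    wd_get _ _ (by omega), tl_get _ _ (by omega)] at h1
  rw [Option.some_inj] at h1
  convert h1 using 3 <;> omega

theorem headw {X q : List (Fin n)} {π τ : Equiv.Perm (Fin n)} {d e : ℕ} (hd : d ≤ n) (he : e ≤ d)
    (h : X ++ wd π = q ++ (tl d τ).take e) (a : ℕ) (h1 : n ≤ a + d) (h2 : a + (d - e) < n) :
    τ ⟨a, by omega⟩ = π ⟨a + (d - e), h2⟩ := by
  have hl := congrArg List.length h
  simp only [List.length_append, wd_length, List.length_take, tl_length hd] at hl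
  have h3 := congrArg (fun l => l[X.length + (a + (d - e))]?) h
  beta_reduce at h3
  rw [List.getElem?_append_right (by omega), List.getElem?_append_right (by omega),
    wd_get _ _ (by omega), List.getElem?_take_of_lt (by omega), tl_get _ _ (by omega)] at h3
  rw [Option.some_inj] at h3
  symm
  convert h3 using 3 <;> omega

theorem good_of_win (hab : ∀ σ ∈ H, ∀ τ ∈ H, σ * τ = τ * σ) {d e : ℕ} (hg : Good H d) (hd : 0 < d)
    {π τ : Equiv.Perm (Fin n)} (hπ : π ∈ H) (hτ : τ ∈ H)
    (h : ∀ (a : ℕ) (ha : a + e < n), n ≤ a + e + d → π ⟨a, by omega⟩ = τ ⟨a + e, ha⟩) :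
    Good H e := by
  obtain ⟨ρ, hρ, hr⟩ := hg
  refine ⟨τ⁻¹ * π, H.mul_mem (H.inv_mem hτ) hπ, ?_⟩
  have hc : ∀ x, (τ⁻¹ * π) (ρ x) = ρ ((τ⁻¹ * π) x) := fun x => by
    have := hab _ (H.mul_mem (H.inv_mem hτ) hπ) _ hρ
    exact congrArg (fun g : Equiv.Perm (Fin n) => g x) this
  suffices ∀ k a : ℕ, ∀ ha : a + e < n, n - a ≤ k → (τ⁻¹ * π) ⟨a, by omega⟩ = ⟨a + e, ha⟩ from
    fun a ha => this n a ha (by omega)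
  intro k
  induction k with
  | zero => intro a ha hk; omega
  | succ k ih =>
    intro a ha hk
    by_cases hb : n ≤ a + e + d
    · rw [Equiv.Perm.mul_apply, h a ha hb, inv_self]
    · have h1 := ih (a + d) (by omega) (by omega)
      rw [← hr a (by omega), hc] at h1
      apply ρ.injective
      rw [h1, hr (a + e) (by omega)]
      simp only [Fin.mk.injEq]; omega

theorem good_sub (hab : ∀ σ ∈ H, ∀ τ ∈ H, σ * τ = τ * σ)
    (hreg : ∀ σ ∈ H, ∀ τ ∈ H, ∀ x, σ x = τ x → σ = τ) {d e : ℕ} (hd : Good H d) (he : Good H e)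
    (he0 : 0 < e) (hed : e < d) (hdn : d < n) {π τ : Equiv.Perm (Fin n)} (hπ : π ∈ H) (hτ : τ ∈ H)
    (h : ∀ (a : ℕ) (_ : n ≤ a + d) (h2 : a + (d - e) < n),
      τ ⟨a, by omega⟩ = π ⟨a + (d - e), h2⟩) : Good H (d - e) := by
  obtain ⟨ρ, hρ, hr⟩ := hd
  obtain ⟨ν, hν, hv⟩ := he
  have hm : ρ * ν⁻¹ ∈ H := H.mul_mem hρ (H.inv_mem hν)
  have h1 : ∀ a (h1 : e ≤ a) (h2 : a + (d - e) < n),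
      (ρ * ν⁻¹) ⟨a, by omega⟩ = ⟨a + (d - e), h2⟩ := by
    intro a h1 h2
    have : (⟨a, by omega⟩ : Fin n) = ν ⟨a - e, by omega⟩ := by
      rw [hv (a - e) (by omega)]; simp only [Fin.mk.injEq]; omega
    rw [this, Equiv.Perm.mul_apply, inv_self, hr _ (by omega)]
    simp only [Fin.mk.injEq]; omega
  have h2 : ρ * ν⁻¹ = π⁻¹ * τ := by
    apply hreg _ hm _ (H.mul_mem (H.inv_mem hπ) hτ) ⟨n - (d - e) - 1, by omega⟩
    rw [h1 _ (by omega) (by omega), Equiv.Perm.mul_apply, h _ (by omega) (by omega),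
      inv_self]
  refine ⟨_, hm, fun a ha => ?_⟩
  by_cases hb : n ≤ a + d
  · rw [h2, Equiv.Perm.mul_apply, h _ hb ha, inv_self]
  · rw [hab _ hρ _ (H.inv_mem hν), Equiv.Perm.mul_apply, hr a (by omega), Equiv.Perm.inv_eq_iff_eq,
      hv _ (by omega)]
    simp only [Fin.mk.injEq]; omega

theorem tl_drop {d e : ℕ} (he : e ≤ d) (hd : d ≤ n) (τ : Equiv.Perm (Fin n)) :
    (tl d τ).drop e = tl (d - e) τ := by
  rw [tl, tl, List.drop_drop]; congr 1; omega

theorem tl_full (τ : Equiv.Perm (Fin n)) : tl n τ = wd τ := by simp [tl]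

theorem good_full (H : Subgroup (Equiv.Perm (Fin n))) : Good H n :=
  ⟨1, H.one_mem, fun a h => by omega⟩

theorem TL_rest (hab : ∀ σ ∈ H, ∀ τ ∈ H, σ * τ = τ * σ)
    (hreg : ∀ σ ∈ H, ∀ τ ∈ H, ∀ x, σ x = τ x → σ = τ) {B : List (Fin n)} (hB : TL H B) :
    ∀ (d : ℕ) (τ : Equiv.Perm (Fin n)) (_ : τ ∈ H) (_ : 0 < d) (_ : d ≤ n) (_ : Good H d)
      (X q r : List (Fin n)) (π : Equiv.Perm (Fin n)) (_ : π ∈ H)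
      (_ : X ++ wd π ++ r = q ++ tl d τ ++ B) (_ : r.length < B.length), TL H r := by
  induction hB with
  | nil => intros; simp at *
  | cons d' τ' B h0 hn hg' hτ' hB ih =>
    intro d τ hτ hd0 hdn hg X q r π hπ heq hr
    by_cases hlt : r.length < B.length
    · exact ih d' τ' hτ' h0 hn.le hg' X (q ++ tl d τ) r π hπ (by simpa using heq) hlt
    · rw [List.length_append, tl_length hn.le] at hr
      obtain ⟨s, hs1, heq2⟩ := splitR heq (by rw [List.length_append, tl_length hn.le]; omega)
      obtain ⟨s', hs2, hs3⟩ := splitR hs1 (by omega)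
      obtain ⟨e, he⟩ : ∃ e, e = s.length := ⟨_, rfl⟩
      have hl := congrArg List.length hs1
      have hl2 := congrArg List.length hs3
      simp only [List.length_append, tl_length hn.le] at hl hl2
      have he0 : 0 < e := by omega
      have hed : e ≤ d' := by omega
      have hst : s = (tl d' τ').take e := by rw [hs3, he]; simp
      have hre : r = (tl d' τ').drop e ++ B := by rw [hs3, hs2, he]; simp
      rw [hst] at heq2
      rw [hre]
      rcases hed.eq_or_lt with h | hlt2
      · rw [h, List.drop_eq_nil_of_le (by rw [tl_length hn.le])]
        simpa using hB
      · rw [tl_drop hed hn.le]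
        have ge : Good H e := good_of_win hab hg hd0 hπ hτ
          (win hdn (by simp [tl_length hn.le]; omega) heq2)
        exact TL.cons _ _ _ (by omega) (by omega)
          (good_sub hab hreg hg' ge he0 hlt2 hn hπ hτ' (headw hn.le hed heq2)) hτ' hB

end ex

section ex2
variable {n : ℕ} {H : Subgroup (Equiv.Perm (Fin n))}

/-- The word is a product with an explicit defining word followed by good tails. -/
def PP (H : Subgroup (Equiv.Perm (Fin n))) (W : List (Fin n)) : Prop :=
  ∃ q B : List (Fin n), ∃ τ ∈ H, W = q ++ wd τ ++ B ∧ TL H B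

theorem PP_step (hab : ∀ σ ∈ H, ∀ τ ∈ H, σ * τ = τ * σ)
    (hreg : ∀ σ ∈ H, ∀ τ ∈ H, ∀ x, σ x = τ x → σ = τ) (hn : 0 < n) (W W' : List (Fin n))
    (h : Step H W W') (hW : PP H W) : PP H W' := by
  obtain ⟨p, r, π, hπ, π', hπ', rfl, rfl⟩ := h
  obtain ⟨q, B, τ, hτ, heq, hB⟩ := hW
  by_cases h1 : r.length < B.length
  · exact ⟨p, r, π', hπ', rfl, TL_rest hab hreg hB n τ hτ hn le_rfl (good_full H) p q r π hπ
      (by rw [heq, tl_full]) h1⟩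
  by_cases h2 : r.length < n + B.length
  · obtain ⟨s, hs1, hs2⟩ := splitR (heq.trans (List.append_assoc _ _ _))
      (by rw [List.length_append, wd_length]; omega)
    obtain ⟨s', hs3, hs4⟩ := splitR hs1 (by omega)
    refine ⟨p, r, π', hπ', rfl, ?_⟩
    rw [hs3]
    obtain ⟨e, he⟩ : ∃ e, e = s.length := ⟨_, rfl⟩
    have hl := congrArg List.length hs1
    have hl4 := congrArg List.length hs4
    simp only [List.length_append, wd_length] at hl hl4
    have hst : s = (tl n τ).take e := by rw [tl_full, hs4, he]; simp
    have hst' : s' = tl (n - e) τ := by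
      rw [← tl_drop (by omega) le_rfl, tl_full, hs4, he]; simp
    rcases Nat.eq_zero_or_pos (n - e) with h0 | h0
    · have : s' = [] := by
        rw [← List.length_eq_zero_iff]; omega
      rw [this]; exact hB
    · rw [hst']
      rw [hst] at hs2
      refine TL.cons _ _ _ h0 (by omega) ?_ hτ hB
      refine good_of_win hab (good_full H) hn hτ hπ fun a ha _ => ?_
      exact headw le_rfl (by omega) hs2 a (by omega) ha
  · obtain ⟨s, hs1, hs2⟩ := splitR (by rw [heq, List.append_assoc] : q ++ (wd τ ++ B) = (p ++ wd π) ++ r)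
      (by rw [List.length_append, wd_length]; omega)
    exact ⟨p ++ wd π' ++ s, B, τ, hτ, by rw [hs1]; simp, hB⟩

theorem PP_end (hab : ∀ σ ∈ H, ∀ τ ∈ H, σ * τ = τ * σ) (hn : 0 < n) {W X : List (Fin n)}
    (hW : PP H W) (i : Fin n) {σ : Equiv.Perm (Fin n)} (hσ : σ ∈ H) (h : W ++ [i] = X ++ wd σ) :
    Good H 1 := by
  obtain ⟨q, B, τ, hτ, rfl, hB⟩ := hW
  suffices ∀ B, TL H B → ∀ d τ q, τ ∈ H → 0 < d → d ≤ n → Good H d →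
      q ++ tl d τ ++ B ++ [i] = X ++ wd σ → Good H 1 from
    this B hB n τ q hτ hn le_rfl (good_full H) (by rw [tl_full]; exact h)
  intro B hB
  induction hB with
  | nil =>
    intro d τ q hτ h0 hd hg h
    rw [List.append_nil] at h
    exact good_of_win hab hg h0 hσ hτ (win hd rfl h.symm)
  | cons d' τ' B h0 hn hg' hτ' hB ih =>
    intro d τ q hτ hd0 hd hg h
    exact ih d' τ' (q ++ tl d τ) hτ' h0 hn.le hg' (by simpa using h)

theorem reg_of_trans (hab : ∀ σ ∈ H, ∀ τ ∈ H, σ * τ = τ * σ) (x0 : Fin n)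
    (ht : ∀ y, ∃ σ ∈ H, σ x0 = y) : ∀ σ ∈ H, ∀ τ ∈ H, ∀ x, σ x = τ x → σ = τ := by
  intro σ hσ τ hτ x hx
  obtain ⟨α, hα, rfl⟩ := ht x
  ext y
  obtain ⟨β, hβ, rfl⟩ := ht y
  have e : ∀ γ ∈ H, γ (β x0) = (β * α⁻¹) (γ (α x0)) := by
    intro γ hγ
    have := hab γ hγ _ (H.mul_mem hβ (H.inv_mem hα))
    have := congrArg (fun g : Equiv.Perm (Fin n) => g (α x0)) this
    simpa using this
  rw [e σ hσ, e τ hτ, hx]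

theorem exE (hab : ∀ σ ∈ H, ∀ τ ∈ H, σ * τ = τ * σ) (hn : 2 ≤ n) (hg : ¬ Good H 1)
    (W : List (Fin n)) :
    ∃ i : Fin n, ∀ p, Eqv H W p → ∀ X, ∀ σ ∈ H, p ++ [i] ≠ X ++ wd σ := by
  have lastw : ∀ (p X : List (Fin n)) (i : Fin n) (σ : Equiv.Perm (Fin n)), p ++ [i] = X ++ wd σ →
      i = σ ⟨n - 1, by omega⟩ ∧ p.getLast? = some (σ ⟨n - 2, by omega⟩) := by
    intro p X i σ h
    have hl := congrArg List.length h
    simp only [List.length_append, wd_length, List.length_singleton] at hl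
    have h1 := congrArg (fun l => l[X.length + (n - 1)]?) h
    have h2 := congrArg (fun l => l[X.length + (n - 2)]?) h
    beta_reduce at h1 h2
    rw [List.getElem?_append_right (by omega), List.getElem?_append_right (by omega),
      wd_get _ _ (by omega)] at h1
    rw [List.getElem?_append_left (by omega), List.getElem?_append_right (by omega),
      wd_get _ _ (by omega)] at h2
    constructor
    · have : X.length + (n - 1) - p.length = 0 := by omega
      rw [this] at h1
      simp at h1
      rw [h1]
    · rw [List.getLast?_eq_getElem?]
      have : p.length - 1 = X.length + (n - 2) := by omega
      rw [this, h2]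
      simp
  by_cases ht : ∀ y, ∃ σ ∈ H, σ ⟨n - 1, by omega⟩ = y
  · have hreg := reg_of_trans hab _ ht
    by_cases hz : ∃ X, ∃ τ ∈ H, Eqv H W (X ++ wd τ)
    · obtain ⟨X, τ, hτ, hX⟩ := hz
      refine ⟨⟨0, by omega⟩, fun p hp Y σ hσ h => hg ?_⟩
      have : PP H p := Eqv.invar (PP_step hab hreg (by omega)) (hX.symm.trans hp)
        ⟨X, [], τ, hτ, by simp, TL.nil⟩
      exact PP_end hab (by omega) this _ hσ h
    · have hlast : ∀ p, Eqv H W p → p.getLast? = W.getLast? := by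
        intro p hp
        refine (Eqv.invar (P := fun V => Eqv H W V ∧ V.getLast? = W.getLast?) ?_ hp
          ⟨.refl, rfl⟩).2
        rintro V V' hs ⟨h1, h2⟩
        refine ⟨h1.tail hs, ?_⟩
        obtain ⟨p, q, σ, hσ, τ, hτ, rfl, rfl⟩ := hs
        have hq : q ≠ [] := by
          rintro rfl
          exact hz ⟨p, σ, hσ, by simpa using h1⟩
        rw [← h2]
        simp [List.getLast?_append, List.getLast?_eq_some_getLast hq]
      by_contra hcon
      push Not at hcon
      obtain ⟨p0, hp0, X0, σ0, hσ0, e0⟩ := hcon ⟨0, by omega⟩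
      obtain ⟨p1, hp1, X1, σ1, hσ1, e1⟩ := hcon ⟨1, by omega⟩
      obtain ⟨a0, b0⟩ := lastw _ _ _ _ e0
      obtain ⟨a1, b1⟩ := lastw _ _ _ _ e1
      rw [hlast _ hp0] at b0
      rw [hlast _ hp1, b0, Option.some_inj] at b1
      have := hreg _ hσ0 _ hσ1 _ b1
      rw [this, ← a1] at a0
      simp at a0
  · push Not at ht
    obtain ⟨i, hi⟩ := ht
    exact ⟨i, fun p _ X σ hσ h => hi σ hσ (lastw _ _ _ _ h).1.symm⟩

/-- Reversal of words. -/
def rv (W : List (Fin n)) : List (Fin n) := (W.map Fin.rev).reverse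

theorem rv_append (A B : List (Fin n)) : rv (A ++ B) = rv B ++ rv A := by simp [rv]

/-- Conjugation by reversal. -/
def cj (σ : Equiv.Perm (Fin n)) : Equiv.Perm (Fin n) := Fin.revPerm * σ * Fin.revPerm

theorem rv_wd (σ : Equiv.Perm (Fin n)) : rv (wd σ) = wd (cj σ) := by
  apply List.ext_getElem
  · simp [rv]
  · intro i h1 h2
    simp [rv, wd, cj]
    congr 1
    simp [Fin.rev]
    simp [rv] at h1
    omega

theorem cj_mul (σ τ : Equiv.Perm (Fin n)) : cj (σ * τ) = cj σ * cj τ := by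
  ext i; simp [cj]

theorem cj_cj (σ : Equiv.Perm (Fin n)) : cj (cj σ) = σ := by
  ext i; simp [cj]

theorem exF (hab : ∀ σ ∈ H, ∀ τ ∈ H, σ * τ = τ * σ) (hn : 2 ≤ n) (hg : ¬ Good H 1)
    (W : List (Fin n)) :
    ∃ i : Fin n, ∀ p, Eqv H W p → ∀ X, ∀ σ ∈ H, i :: p ≠ wd σ ++ X := by
  let f : Equiv.Perm (Fin n) →* Equiv.Perm (Fin n) := MonoidHom.mk' cj cj_mul
  let H' := H.map f
  have hH' : ∀ σ ∈ H, cj σ ∈ H' := fun σ hσ => ⟨σ, hσ, rfl⟩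
  have hst : ∀ V V', Step H V V' → Step H' (rv V) (rv V') := by
    rintro V V' ⟨p, q, σ, hσ, τ, hτ, rfl, rfl⟩
    exact ⟨rv q, rv p, cj σ, hH' σ hσ, cj τ, hH' τ hτ, by simp [rv_append, rv_wd],
      by simp [rv_append, rv_wd]⟩
  have heq : ∀ V V', Eqv H V V' → Eqv H' (rv V) (rv V') := by
    intro V V' h
    exact Eqv.invar (P := fun U => Eqv H' (rv V) (rv U)) (fun U U' hU h => h.tail (hst _ _ hU)) h .refl
  have hab' : ∀ σ ∈ H', ∀ τ ∈ H', σ * τ = τ * σ := by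
    rintro _ ⟨σ, hσ, rfl⟩ _ ⟨τ, hτ, rfl⟩
    rw [← map_mul, ← map_mul, hab σ hσ τ hτ]
  have hg' : ¬ Good H' 1 := by
    rintro ⟨_, ⟨ρ, hρ, rfl⟩, hr⟩
    apply hg
    refine ⟨ρ⁻¹, H.inv_mem hρ, fun a ha => ?_⟩
    rw [Equiv.Perm.inv_eq_iff_eq]
    have := hr (n - 2 - a) (by omega)
    simp only [f, MonoidHom.mk'_apply, cj, Equiv.Perm.mul_apply, Fin.revPerm_apply] at this
    rw [Fin.rev_eq_iff] at this
    have e1 : (Fin.rev ⟨n - 2 - a, by omega⟩ : Fin n) = ⟨a + 1, ha⟩ := by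
      ext; simp [Fin.rev]; omega
    have e2 : (Fin.rev ⟨n - 2 - a + 1, by omega⟩ : Fin n) = ⟨a, by omega⟩ := by
      ext; simp [Fin.rev]; omega
    rw [e1, e2] at this
    exact this.symm
  obtain ⟨i, hi⟩ := exE hab' hn hg' (rv W)
  refine ⟨Fin.rev i, fun p hp X σ hσ h => hi (rv p) (heq _ _ hp) (rv X) (cj σ) (hH' σ hσ) ?_⟩
  rw [← rv_wd, ← rv_append, ← h]
  simp [rv]

end ex2

section sep
variable {n : ℕ} {H : Subgroup (Equiv.Perm (Fin n))}

theorem wd_no_dup {σ : Equiv.Perm (Fin n)} {X Y : List (Fin n)} {a : Fin n} {k : ℕ}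
    (h1 : (X ++ wd σ ++ Y)[k]? = some a) (h2 : (X ++ wd σ ++ Y)[k + 1]? = some a) :
    k < X.length ∨ X.length + n ≤ k + 1 := by
  by_contra hc
  push Not at hc
  rw [List.getElem?_append_left (by simp; omega), List.getElem?_append_right (by omega),
    wd_get _ _ (by omega)] at h1 h2
  rw [Option.some_inj] at h1 h2
  have := σ.injective (h1.trans h2.symm)
  simp at this
  omega

theorem sep (hn : 3 ≤ n) {σ : Equiv.Perm (Fin n)} {X Y p q : List (Fin n)} {i f : Fin n}
    (h : X ++ wd σ ++ Y = p ++ [i, i, f, f] ++ q) :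
    (∃ Y', p ++ [i] = X ++ wd σ ++ Y' ∧ Y = Y' ++ ([i, f, f] ++ q)) ∨
    (∃ X', f :: q = X' ++ (wd σ ++ Y) ∧ X = p ++ [i, i, f] ++ X') := by
  have g0 : (p ++ [i, i, f, f] ++ q)[p.length]? = some i := by simp
  have g1 : (p ++ [i, i, f, f] ++ q)[p.length + 1]? = some i := by simp
  have g2 : (p ++ [i, i, f, f] ++ q)[p.length + 2]? = some f := by simp
  have g3' : (p ++ [i, i, f, f] ++ q)[p.length + 3]? = some f := by simp
  have g3 : (p ++ [i, i, f, f] ++ q)[p.length + 2 + 1]? = some f := g3'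
  rw [← h] at g0 g1 g2 g3
  have d1 := wd_no_dup g0 g1
  have d2 := wd_no_dup g2 g3
  have hl := congrArg List.length h
  simp only [List.length_append, wd_length, List.length_cons, List.length_nil] at hl
  by_cases hx : X.length + n ≤ p.length + 1
  · left
    obtain ⟨s, h1, h2⟩ := splitR (A := p ++ [i]) (r := [i, f, f] ++ q) (P := X ++ wd σ) (Q := Y)
      (by rw [h]; simp) (by simp; omega)
    exact ⟨s, h2, h1⟩
  · right
    obtain ⟨s, h1, h2⟩ := splitR (A := X) (r := wd σ ++ Y) (P := p ++ [i, i, f]) (Q := f :: q)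
      (by rw [← List.append_assoc, h]; simp) (by simp; omega)
    exact ⟨s, h1, h2⟩

theorem sep_class (hn : 3 ≤ n ∨ ∀ σ ∈ H, σ = 1) {S T : List (Fin n)} {i f : Fin n}
    (hi : ∀ p, Eqv H S p → ∀ X, ∀ σ ∈ H, p ++ [i] ≠ X ++ wd σ)
    (hf : ∀ p, Eqv H T p → ∀ X, ∀ σ ∈ H, f :: p ≠ wd σ ++ X) {V : List (Fin n)}
    (hV : Eqv H (S ++ [i, i, f, f] ++ T) V) :
    ∃ p q, V = p ++ [i, i, f, f] ++ q ∧ Eqv H S p ∧ Eqv H T q := by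
  refine Eqv.invar (P := fun V => ∃ p q, V = p ++ [i, i, f, f] ++ q ∧ Eqv H S p ∧ Eqv H T q)
    ?_ hV ⟨S, T, rfl, .refl, .refl⟩
  rintro V V' ⟨X, Y, σ, hσ, τ, hτ, rfl, rfl⟩ ⟨p, q, h, hp, hq⟩
  rcases hn with hn | hn
  · rcases sep hn h with ⟨Y', h1, h2⟩ | ⟨X', h1, h2⟩
    · rcases List.eq_nil_or_concat Y' with rfl | ⟨Z, b, rfl⟩
      · exact absurd (by simpa using h1) (hi p hp X σ hσ)
      · rw [List.concat_eq_append, ← List.append_assoc] at h1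
        obtain ⟨h3, h4⟩ := List.append_inj' h1 rfl
        simp only [List.cons.injEq, and_true] at h4
        subst h3 h4
        refine ⟨X ++ wd τ ++ Z, q, by rw [h2]; simp, hp.tail ⟨X, Z, σ, hσ, τ, hτ, rfl, rfl⟩, hq⟩
    · cases X' with
      | nil => exact absurd (by simpa using h1) (hf q hq Y σ hσ)
      | cons b Z =>
        simp only [List.cons_append, List.cons.injEq] at h1
        obtain ⟨rfl, rfl⟩ := h1
        refine ⟨p, Z ++ wd τ ++ Y, by rw [h2]; simp, hp,
          hq.tail ⟨Z, Y, σ, hσ, τ, hτ, by simp, rfl⟩⟩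
  · rw [hn σ hσ] at h
    rw [hn τ hτ]
    exact ⟨p, q, h, hp, hq⟩

/-- Length of an element. -/
noncomputable def len (s : SnMonoid n ↑H) : ℕ := (rep s).length

theorem len_pi (W : List (Fin n)) : len (pi H W) = W.length := (rep_pi W).length

variable (H) in
open Classical in
/-- The separators. -/
noncomputable def CC : Finset (SnMonoid n ↑H) :=
  Finset.univ.image fun x : Fin n × Fin n => pi H [x.1, x.1, x.2, x.2]

theorem mem_CC {c : SnMonoid n ↑H} : c ∈ CC H ↔ ∃ i f, pi H [i, i, f, f] = c := by
  simp [CC]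

theorem caseD (K : Type) [Field K] (hab : ∀ σ ∈ H, ∀ τ ∈ H, σ * τ = τ * σ) (hn : 2 ≤ n)
    (hg : ¬ Good H 1) (hn' : 3 ≤ n ∨ ∀ σ ∈ H, σ = 1) :
    (⊥ : Ideal (MonoidAlgebra K (SnMonoid n ↑H))).jacobson = ⊥ := by
  apply crit (CC H)
  intro A B hA hB
  obtain ⟨s, hs, hsm⟩ := Finset.exists_max_image A len hA
  obtain ⟨t, ht, htm⟩ := Finset.exists_max_image B len hB
  obtain ⟨i, hi⟩ := exE hab hn hg (rep s)
  obtain ⟨f, hf⟩ := exF hab hn hg (rep t)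
  have hm : ∀ (s t : SnMonoid n ↑H) (W : List (Fin n)),
      s * pi H W * t = pi H (rep s ++ W ++ rep t) := by
    intro s t W
    simp only [pi_append, pi_rep]
  have hlen : len (s * pi H [i, i, f, f] * t) = len s + 4 + len t := by
    rw [hm, len_pi]; simp [len]; omega
  refine ⟨s, hs, pi H [i, i, f, f], mem_CC.2 ⟨i, f, rfl⟩, t, ht, ?_, ?_, ?_⟩
  · intro s' hs' c' hc' t' ht' he
    obtain ⟨j, g, rfl⟩ := mem_CC.1 hc'
    rw [hm, hm, pi_eq_iff] at he
    obtain ⟨p, q, h1, h2, h3⟩ := sep_class hn' hi hf he.symm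
    have l1 := hsm s' hs'
    have l2 := htm t' ht'
    have l3 := h2.length
    have l4 := h3.length
    have l5 := congrArg List.length h1
    simp only [List.length_append, List.length_cons, List.length_nil] at l5
    unfold len at l1 l2
    obtain ⟨e1, e2⟩ := List.append_inj h1 (by simp; omega)
    obtain ⟨e3, e4⟩ := List.append_inj e1 (by omega)
    refine ⟨?_, by rw [e4], ?_⟩
    · rw [← pi_rep s', ← pi_rep s, e3, pi_eq_iff]; exact h2.symm
    · rw [← pi_rep t', ← pi_rep t, e2, pi_eq_iff]; exact h3.symm
  · intro h
    have := hsm _ h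
    omega
  · intro h
    rw [h, ← pi_nil, len_pi] at hlen
    simp at hlen
    omega

theorem case0 (K : Type) [Field K] (hn : n = 0) :
    (⊥ : Ideal (MonoidAlgebra K (SnMonoid n ↑H))).jacobson = ⊥ := by
  subst hn
  have hs : ∀ s : SnMonoid 0 ↑H, s = 1 := by
    intro s
    rw [← pi_rep s, ← pi_nil]
    congr 1
    exact List.eq_nil_of_length_eq_zero (by
      cases h : rep s with
      | nil => rfl
      | cons a _ => exact a.elim0)
  rw [eq_bot_iff]
  intro x hx
  rw [Ideal.mem_bot]
  by_contra hx0
  rw [Ideal.mem_jacobson_iff] at hx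
  have hx1 : x = MonoidAlgebra.single 1 (x.coeff 1) := by
    ext s
    rw [hs s]; simp
  have hc : x.coeff 1 ≠ 0 := by
    intro h
    rw [h] at hx1
    exact hx0 (by rw [hx1]; simp)
  obtain ⟨y, hy⟩ := hx (MonoidAlgebra.single 1 (-(x.coeff 1)⁻¹))
  rw [Ideal.mem_bot, mul_assoc] at hy
  have : (MonoidAlgebra.single 1 (-(x.coeff 1)⁻¹) : MonoidAlgebra K (SnMonoid 0 ↑H)) * x = -1 := by
    rw [hx1, MonoidAlgebra.single_mul_single, MonoidAlgebra.one_def]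
    simp [hc]
  rw [this] at hy
  simp at hy

theorem caseB (K : Type) [Field K] (hn0 : 0 < n) (hn : n ≤ 2) (hg : Good H 1) :
    (⊥ : Ideal (MonoidAlgebra K (SnMonoid n ↑H))).jacobson = ⊥ := by
  have hcomm : ∀ a b : Fin n, Eqv H [a, b] [b, a] := by
    intro a b
    by_cases hab : a = b
    · rw [hab]; exact .refl
    obtain rfl : n = 2 := by
      have := a.2; have := b.2
      have : a.1 ≠ b.1 := fun h => hab (Fin.ext h)
      omega
    obtain ⟨ρ, hρ, hr⟩ := hg
    have h0 : ρ 0 = 1 := hr 0 (by omega)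
    have h1 : ρ 1 = 0 := by
      have : ρ 1 ≠ ρ 0 := fun h => by simpa using ρ.injective h
      rw [h0] at this
      omega
    have hs : Eqv H [0, 1] [1, 0] := Relation.ReflTransGen.single
      ⟨[], [], 1, H.one_mem, ρ, hρ, by simp [wd], by simp [wd, h0, h1]⟩
    fin_cases a <;> fin_cases b
    · exact .refl
    · exact hs
    · exact hs.symm
    · exact .refl
  have hperm : ∀ V V' : List (Fin n), V.Perm V' → Eqv H V V' := by
    intro V V' h
    induction h with
    | nil => exact .refl
    | cons a _ ih => simpa using ih.ctx [a] []
    | swap a b l => simpa using (hcomm b a).ctx [] l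
    | trans _ _ h1 h2 => exact h1.trans h2
  have hEp : ∀ V V' : List (Fin n), Eqv H V V' → V.Perm V' := by
    intro V V' h
    refine Eqv.invar (P := fun U => V.Perm U) ?_ h (List.Perm.refl _)
    rintro U U' ⟨X, Y, σ, hσ, τ, hτ, rfl, rfl⟩ h
    refine h.trans ?_
    refine List.Perm.append_right _ (List.Perm.append_left _ ?_)
    have : ∀ σ : Equiv.Perm (Fin n), (wd σ).Perm (List.finRange n) := by
      intro σ
      rw [List.perm_ext_iff_of_nodup (wd_nodup σ) (List.nodup_finRange n)]
      intro a
      simp only [List.mem_finRange, iff_true, wd, List.mem_ofFn]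
      exact ⟨σ.symm a, by simp⟩
    exact (this σ).trans (this τ).symm
  let o : Fin n := ⟨0, hn0⟩
  let g : SnMonoid n ↑H → ℕ ×ₗ ℕ := fun s => toLex ((rep s).length, (rep s).count o)
  have gpi : ∀ W, g (pi H W) = toLex (W.length, W.count o) := by
    intro W
    have := hEp _ _ (rep_pi (H := H) W)
    simp only [g, this.length_eq, this.count_eq]
  have gmul : ∀ s t, g (s * t) = g s + g t := by
    intro s t
    rw [← pi_rep s, ← pi_rep t, ← pi_append, gpi, gpi, gpi, ← toLex_add]
    simp
  have ginj : ∀ s t, g s = g t → s = t := by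
    intro s t h
    have h' := toLex.injective h
    simp only [Prod.mk.injEq] at h'
    rw [← pi_rep s, ← pi_rep t, pi_eq_iff]
    apply hperm
    rw [List.perm_iff_count]
    intro a
    by_cases ha : a = o
    · rw [ha]; exact h'.2
    · have key : ∀ l : List (Fin n), l.count o + l.count a = l.length := by
        intro l
        induction l with
        | nil => simp
        | cons b l ih =>
          have hb : (b = o ∧ b ≠ a) ∨ (b ≠ o ∧ b = a) := by
            by_cases hb : b = o
            · exact Or.inl ⟨hb, fun h => ha (h ▸ hb)⟩
            · refine Or.inr ⟨hb, ?_⟩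
              have h1 : b.1 ≠ 0 := fun h => hb (Fin.ext h)
              have h2 : a.1 ≠ 0 := fun h => ha (Fin.ext h)
              ext; omega
          rcases hb with ⟨rfl, hb⟩ | ⟨hb, rfl⟩
          · rw [List.count_cons_self, List.count_cons_of_ne hb, List.length_cons]; omega
          · rw [List.count_cons_self, List.count_cons_of_ne hb, List.length_cons]; omega
      have k1 := key (rep s)
      have k2 := key (rep t)
      omega
  apply crit {pi H [o]}
  intro A B hA hB
  obtain ⟨s, hs, hsm⟩ := Finset.exists_max_image A g hA
  obtain ⟨t, ht, htm⟩ := Finset.exists_max_image B g hB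
  have hl : ∀ s t : SnMonoid n ↑H, len (s * t) = len s + len t := by
    intro s t
    conv_lhs => rw [← pi_rep s, ← pi_rep t, ← pi_append, len_pi, List.length_append]
    rfl
  refine ⟨s, hs, _, Finset.mem_singleton_self _, t, ht, ?_, ?_, ?_⟩
  · intro s' hs' c' hc' t' ht' he
    rw [Finset.mem_singleton] at hc'
    subst hc'
    have h1 := hsm s' hs'
    have h2 := htm t' ht'
    have h3 := congrArg g he
    rw [gmul, gmul, gmul, gmul] at h3
    have h4 : g s' = g s := by
      by_contra hne
      have := add_lt_add_of_lt_of_le (add_lt_add_left (lt_of_le_of_ne h1 hne) (g (pi H [o]))) h2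
      exact absurd h3 this.ne
    rw [h4] at h3
    exact ⟨ginj _ _ h4, rfl, ginj _ _ (add_left_cancel h3)⟩
  · intro h
    have h1 := hsm _ h
    have h2 := (Prod.Lex.le_iff.1 h1)
    have h3 : len (s * pi H [o] * t) ≤ len s := by
      rcases h2 with h2 | h2
      · exact le_of_lt h2
      · exact le_of_eq h2.1
    rw [hl, hl, len_pi] at h3
    simp at h3
    omega
  · intro h
    have := congrArg len h
    rw [hl, hl, len_pi, ← pi_nil, len_pi] at this
    simp at this

end sep

section cyc
variable {n : ℕ} {H : Subgroup (Equiv.Perm (Fin n))}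

/-- Defining words of elements of `H`. -/
def IsH (H : Subgroup (Equiv.Perm (Fin n))) (L : List (Fin n)) : Prop := ∃ σ ∈ H, L = wd σ

theorem IsH.length {L : List (Fin n)} (h : IsH H L) : L.length = n := by
  obtain ⟨σ, _, rfl⟩ := h
  simp

/-- Words without defining words as factors. -/
def HFree (H : Subgroup (Equiv.Perm (Fin n))) (w : List (Fin n)) : Prop :=
  ∀ X L Y, IsH H L → w ≠ X ++ L ++ Y

theorem HFree.left {v w : List (Fin n)} (h : HFree H (v ++ w)) : HFree H v := by
  intro X L Y hL e
  exact h X L (Y ++ w) hL (by rw [e]; simp)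

open Classical in
/-- Add a letter to a stack, removing a defining word at the end. -/
noncomputable def push (H : Subgroup (Equiv.Perm (Fin n))) (s : ℕ × List (Fin n)) (a : Fin n) :
    ℕ × List (Fin n) :=
  if ∃ v L, IsH H L ∧ s.2 ++ [a] = v ++ L then (s.1 + 1, s.2.take (s.2.length + 1 - n))
  else (s.1, s.2 ++ [a])

theorem push_pop (hn : 0 < n) {k : ℕ} {w v L : List (Fin n)} {a : Fin n} (hL : IsH H L)
    (h : w ++ [a] = v ++ L) : push H (k, w) a = (k + 1, v) := by
  unfold push
  rw [if_pos ⟨v, L, hL, h⟩]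
  have hl := hL.length
  rcases List.eq_nil_or_concat L with rfl | ⟨L', c, rfl⟩
  · simp at hl; omega
  rw [List.concat_eq_append] at h hl
  rw [← List.append_assoc] at h
  obtain ⟨h1, -⟩ := List.append_inj' h rfl
  subst h1
  simp only [List.length_append, List.length_cons, List.length_nil] at hl ⊢
  rw [show v.length + L'.length + 1 - n = v.length by omega]
  simp

theorem push_no {k : ℕ} {w : List (Fin n)} {a : Fin n}
    (h : ¬ ∃ v L, IsH H L ∧ w ++ [a] = v ++ L) : push H (k, w) a = (k, w ++ [a]) := by
  unfold push
  rw [if_neg h]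

theorem free_snoc {w : List (Fin n)} {a : Fin n} (hw : HFree H w)
    (h : ¬ ∃ v L, IsH H L ∧ w ++ [a] = v ++ L) : HFree H (w ++ [a]) := by
  intro X L Y hL e
  rcases List.eq_nil_or_concat Y with rfl | ⟨Y', c, rfl⟩
  · exact h ⟨X, L, hL, by simpa using e⟩
  · rw [List.concat_eq_append, ← List.append_assoc] at e
    obtain ⟨h1, -⟩ := List.append_inj' e rfl
    exact absurd h1 (hw X L _ hL)

/-- Process a word. -/
noncomputable def run (H : Subgroup (Equiv.Perm (Fin n))) (s : ℕ × List (Fin n))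
    (L : List (Fin n)) : ℕ × List (Fin n) := L.foldl (push H) s

theorem run_append (s : ℕ × List (Fin n)) (A B : List (Fin n)) :
    run H s (A ++ B) = run H (run H s A) B := List.foldl_append

theorem run_cons (s : ℕ × List (Fin n)) (a : Fin n) (B : List (Fin n)) :
    run H s (a :: B) = run H (push H s a) B := rfl

theorem run_free (B : List (Fin n)) : ∀ (k : ℕ) (v : List (Fin n)), HFree H (v ++ B) →
    run H (k, v) B = (k, v ++ B) := by
  induction B with
  | nil => intro k v _; simp [run]
  | cons b B ih =>
    intro k v h
    rw [run_cons, push_no, ih]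
    · simp
    · simpa using h
    · rintro ⟨u, L, hL, e⟩
      exact h u L B hL (by rw [← e]; simp)

theorem push_hfree (hn : 0 < n) (s : ℕ × List (Fin n)) (a : Fin n) (h : HFree H s.2) :
    HFree H (push H s a).2 := by
  obtain ⟨k, w⟩ := s
  by_cases hp : ∃ v L, IsH H L ∧ w ++ [a] = v ++ L
  · obtain ⟨v, L, hL, e⟩ := hp
    rw [push_pop hn hL e]
    have hl := hL.length
    obtain ⟨s, -, h2⟩ := splitR (A := w) (r := [a]) (P := v) (Q := L) e (by simp; omega)
    simp only at h ⊢
    rw [h2] at h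
    exact h.left
  · rw [push_no hp]
    exact free_snoc h hp

theorem run_hfree (hn : 0 < n) (L : List (Fin n)) : ∀ s : ℕ × List (Fin n), HFree H s.2 →
    HFree H (run H s L).2 := by
  induction L with
  | nil => intro s h; exact h
  | cons a L ih => intro s h; exact ih _ (push_hfree hn s a h)

theorem nil_hfree (hn : 0 < n) : HFree H [] := by
  intro X L Y hL e
  have := congrArg List.length e
  have := hL.length
  simp at *
  omega

theorem run_len (hn : 0 < n) (L : List (Fin n)) : ∀ (k : ℕ) (w : List (Fin n)),
    run H (k, w) L = (k, w ++ L) ∨ (run H (k, w) L).2.length < w.length + L.length := by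
  induction L with
  | nil => intro k w; left; simp [run]
  | cons a L ih =>
    intro k w
    rw [run_cons]
    by_cases hp : ∃ v L, IsH H L ∧ w ++ [a] = v ++ L
    · obtain ⟨v, L', hL, e⟩ := hp
      rw [push_pop hn hL e]
      right
      have hl := hL.length
      have hl2 := congrArg List.length e
      simp only [List.length_append, List.length_cons, List.length_nil] at hl2 ⊢
      rcases ih (k + 1) v with h | h
      · rw [h]; simp; omega
      · omega
    · rw [push_no hp]
      rcases ih k (w ++ [a]) with h | h
      · left; rw [h]; simp
      · right; simp at h ⊢; omega

theorem run_wd (hn : 0 < n) (hR : ∀ X Y, IsH H (X ++ Y) → IsH H (Y ++ X))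
    (hU : ∀ X Y a, IsH H (X ++ [a]) → IsH H (Y ++ [a]) → X = Y) (B : List (Fin n)) :
    ∀ (k : ℕ) (w A : List (Fin n)), HFree H (w ++ A) → IsH H (A ++ B) →
      run H (k, w ++ A) B = (k + 1, w) := by
  induction B with
  | nil =>
    intro k w A h1 h2
    exact absurd (by simp) (h1 w (A ++ []) [] h2)
  | cons b B ih =>
    intro k w A h1 h2
    rw [run_cons]
    by_cases hp : ∃ v L, IsH H L ∧ w ++ A ++ [b] = v ++ L
    · obtain ⟨v, L, hL, e⟩ := hp
      rw [push_pop hn hL e]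
      have hl := hL.length
      obtain ⟨s, h3, h4⟩ := splitR (A := w ++ A) (r := [b]) (P := v) (Q := L) e (by simp; omega)
      subst h3
      have h5 : IsH H ((B ++ A) ++ [b]) := by
        have := hR (A ++ [b]) B (by simpa using h2)
        simpa using this
      obtain rfl := hU _ _ _ hL h5
      rw [← List.append_assoc] at h4
      obtain ⟨rfl, -⟩ := List.append_inj' h4 rfl
      exact run_free B _ _ h1.left
    · rw [push_no hp]
      have := ih k w (A ++ [b]) (by rw [← List.append_assoc]; exact free_snoc h1 hp)
        (by simpa using h2)
      simpa using this

theorem isH_rot (hn : 0 < n) (hg : Good H 1) : ∀ X Y, IsH H (X ++ Y) → IsH H (Y ++ X) := by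
  obtain ⟨ρ, hρ, hr⟩ := hg
  have hr0 : ρ ⟨n - 1, by omega⟩ = ⟨0, hn⟩ := by
    obtain ⟨⟨y, hy⟩, h⟩ := ρ.surjective ⟨0, hn⟩
    by_cases hy1 : y + 1 < n
    · rw [hr y hy1] at h
      simp at h
    · rw [← h]; congr 2; omega
  have h1 : ∀ a B, IsH H (a :: B) → IsH H (B ++ [a]) := by
    rintro a B ⟨σ, hσ, h⟩
    refine ⟨σ * ρ, H.mul_mem hσ hρ, ?_⟩
    have hl := congrArg List.length h
    simp only [wd_length, List.length_cons] at hl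
    refine List.ext_getElem? fun i => ?_
    by_cases hi : i + 1 < n
    · rw [wd_get _ _ (by omega), List.getElem?_append_left (by omega)]
      have h2 := congrArg (fun l => l[i + 1]?) h
      beta_reduce at h2
      rw [wd_get _ _ hi] at h2
      simp only [List.getElem?_cons_succ] at h2
      rw [h2, Equiv.Perm.mul_apply, hr i hi]
    · by_cases hi2 : i < n
      · obtain rfl : i = n - 1 := by omega
        rw [wd_get _ _ (by omega), List.getElem?_append_right (by omega),
          Equiv.Perm.mul_apply, hr0]
        have h2 := congrArg (fun l => l[0]?) h
        beta_reduce at h2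
        rw [wd_get _ _ hn] at h2
        rw [show n - 1 - B.length = 0 by omega]
        simpa using h2
      · rw [List.getElem?_eq_none (by simp; omega), List.getElem?_eq_none (by simp; omega)]
  intro X
  induction X with
  | nil => intro Y h; simpa using h
  | cons a X ih =>
    intro Y h
    have := ih (Y ++ [a]) (by simpa using h1 a (X ++ Y) h)
    simpa using this

theorem isH_uniq (hab : ∀ σ ∈ H, ∀ τ ∈ H, σ * τ = τ * σ) (hn : 0 < n) (hg : Good H 1) :
    ∀ X Y a, IsH H (X ++ [a]) → IsH H (Y ++ [a]) → X = Y := by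
  obtain ⟨ρ, hρ, hr⟩ := hg
  have ht : ∀ y : Fin n, ∃ σ ∈ H, σ ⟨0, hn⟩ = y := by
    rintro ⟨y, hy⟩
    induction y with
    | zero => exact ⟨1, H.one_mem, rfl⟩
    | succ y ih =>
      obtain ⟨σ, hσ, h⟩ := ih (by omega)
      exact ⟨ρ * σ, H.mul_mem hρ hσ, by rw [Equiv.Perm.mul_apply, h, hr y hy]⟩
  have hreg := reg_of_trans hab ⟨0, hn⟩ ht
  rintro X Y a ⟨σ, hσ, h1⟩ ⟨τ, hτ, h2⟩
  have key : ∀ (Z : List (Fin n)) (π : Equiv.Perm (Fin n)), Z ++ [a] = wd π →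
      π ⟨n - 1, by omega⟩ = a := by
    intro Z π h
    have hl := congrArg List.length h
    simp only [wd_length, List.length_append, List.length_cons, List.length_nil] at hl
    have h2 := congrArg (fun l => l[n - 1]?) h
    beta_reduce at h2
    rw [wd_get _ _ (by omega), List.getElem?_append_right (by omega),
      show n - 1 - Z.length = 0 by omega] at h2
    simpa using h2.symm
  have := hreg σ hσ τ hτ _ ((key X σ h1).trans (key Y τ h2).symm)
  rw [this, ← h2] at h1
  exact List.append_cancel_right h1

theorem free_dup_last (hn : 3 ≤ n) (w : List (Fin n)) (hw : HFree H w) :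
    ∃ i, HFree H (w ++ [i]) := by
  rcases List.eq_nil_or_concat w with rfl | ⟨w', i, rfl⟩
  · refine ⟨⟨0, by omega⟩, ?_⟩
    intro X L Y hL e
    have := congrArg List.length e
    have := hL.length
    simp at *
    omega
  · refine ⟨i, free_snoc hw ?_⟩
    rintro ⟨v, L, ⟨σ, hσ, rfl⟩, e⟩
    rw [List.concat_eq_append] at e
    have hl := congrArg List.length e
    simp only [wd_length, List.length_append, List.length_cons, List.length_nil] at hl
    have g0 : (w' ++ [i] ++ [i])[w'.length]? = some i := by simp
    have g1 : (w' ++ [i] ++ [i])[w'.length + 1]? = some i := by simp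
    rw [e] at g0 g1
    have := wd_no_dup (Y := []) (by simpa using g0) (by simpa using g1)
    omega

theorem free_dup_first (hn : 3 ≤ n) (w : List (Fin n)) (hw : HFree H w) :
    ∃ i, HFree H (i :: w) := by
  cases w with
  | nil =>
    refine ⟨⟨0, by omega⟩, ?_⟩
    intro X L Y hL e
    have := congrArg List.length e
    have := hL.length
    simp at *
    omega
  | cons i w =>
    refine ⟨i, ?_⟩
    rintro X L Y ⟨σ, hσ, rfl⟩ e
    cases X with
    | nil =>
      have g0 : (i :: i :: w)[0]? = some i := by simp
      have g1 : (i :: i :: w)[0 + 1]? = some i := by simp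
      rw [e] at g0 g1
      have := wd_no_dup g0 g1
      simp at this
      omega
    | cons b X =>
      simp only [List.cons_append, List.cons.injEq] at e
      exact hw X _ Y ⟨σ, hσ, rfl⟩ e.2

theorem free_sep (hn : 3 ≤ n) {p q : List (Fin n)} {i f : Fin n} (h1 : HFree H (p ++ [i]))
    (h2 : HFree H (f :: q)) : HFree H (p ++ [i, i, f, f] ++ q) := by
  rintro X L Y ⟨σ, hσ, rfl⟩ e
  rcases sep hn e.symm with ⟨Y', h, -⟩ | ⟨X', h, -⟩
  · exact h1 X _ Y' ⟨σ, hσ, rfl⟩ h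
  · exact h2 X' _ Y ⟨σ, hσ, rfl⟩ (by simpa using h)

theorem caseC (K : Type) [Field K] (hab : ∀ σ ∈ H, ∀ τ ∈ H, σ * τ = τ * σ) (hn : 3 ≤ n)
    (hg : Good H 1) : (⊥ : Ideal (MonoidAlgebra K (SnMonoid n ↑H))).jacobson = ⊥ := by
  have hn0 : 0 < n := by omega
  have hR := isH_rot hn0 hg
  have hU := isH_uniq hab hn0 hg
  have hwd : ∀ σ ∈ H, ∀ k w, HFree H w → run H (k, w) (wd σ) = (k + 1, w) := by
    intro σ hσ k w hw
    have := run_wd hn0 hR hU (wd σ) k w [] (by simpa using hw) ⟨σ, hσ, by simp⟩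
    simpa using this
  have hinv : ∀ W W', Eqv H W W' → run H (0, []) W = run H (0, []) W' := by
    intro W W' h
    refine Eqv.invar (P := fun V => run H (0, []) W = run H (0, []) V) ?_ h rfl
    rintro V V' ⟨p, q, σ, hσ, τ, hτ, rfl, rfl⟩ e
    rw [e]
    have hf := run_hfree (H := H) hn0 p (0, []) (nil_hfree hn0)
    simp only [run_append]
    generalize run H (0, []) p = s at hf
    obtain ⟨k, w⟩ := s
    rw [hwd σ hσ k w hf, hwd τ hτ k w hf]
  set z := pi H (wd 1) with hz
  have hzH : ∀ L, IsH H L → pi H L = z := by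
    rintro L ⟨σ, hσ, rfl⟩
    exact pi_wd σ hσ
  have hzc : ∀ W, z * pi H W = pi H W * z := by
    have h1 : ∀ a : Fin n, z * pi H [a] = pi H [a] * z := by
      intro a
      have hmem : a ∈ wd (1 : Equiv.Perm (Fin n)) := by
        simp [wd, List.mem_ofFn]
      obtain ⟨X, Y, e⟩ := List.append_of_mem hmem
      have h2 : IsH H (X ++ a :: Y) := ⟨1, H.one_mem, e.symm⟩
      have h3 : IsH H ((a :: Y) ++ X) := hR _ _ h2
      have h4 : IsH H ((Y ++ X) ++ [a]) := by
        have := hR [a] (Y ++ X) (by simpa using h3)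
        simpa using this
      conv_lhs => rw [← hzH _ h3]
      rw [← hzH _ h4, ← pi_append, ← pi_append]
      simp
    intro W
    induction W with
    | nil => simp [pi_nil]
    | cons a W ih =>
      rw [← List.singleton_append, pi_append, ← mul_assoc, h1, mul_assoc, ih, mul_assoc]
  let val : ℕ × List (Fin n) → SnMonoid n ↑H := fun s => z ^ s.1 * pi H s.2
  have hpush : ∀ s a, val (push H s a) = val s * pi H [a] := by
    rintro ⟨k, w⟩ a
    by_cases hp : ∃ v L, IsH H L ∧ w ++ [a] = v ++ L
    · obtain ⟨v, L, hL, e⟩ := hp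
      rw [push_pop hn0 hL e]
      simp only [val]
      rw [mul_assoc, ← pi_append, e, pi_append, hzH L hL, ← hzc, pow_succ, mul_assoc]
    · rw [push_no hp]
      simp only [val]
      rw [pi_append, mul_assoc]
  have hrun : ∀ L s, val (run H s L) = val s * pi H L := by
    intro L
    induction L with
    | nil => intro s; simp [run, pi_nil]
    | cons a L ih =>
      intro s
      rw [run_cons, ih, hpush, mul_assoc, ← pi_append]
      rfl
  let nf : SnMonoid n ↑H → ℕ × List (Fin n) := fun s => run H (0, []) (rep s)
  have hnf_pi : ∀ W, nf (pi H W) = run H (0, []) W := fun W => hinv _ _ (rep_pi W)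
  have hval : ∀ s, val (nf s) = s := by
    intro s
    simp only [nf]
    rw [hrun, pi_rep]
    simp [val, pi_nil]
  have hfree : ∀ s, HFree H (nf s).2 := fun s => run_hfree hn0 _ _ (nil_hfree hn0)
  have hzp : ∀ m, ∃ Z, pi H Z = z ^ m ∧ run H (0, []) Z = (m, []) := by
    intro m
    induction m with
    | zero => exact ⟨[], by simp [pi_nil], rfl⟩
    | succ m ih =>
      obtain ⟨Z, h1, h2⟩ := ih
      exact ⟨Z ++ wd 1, by rw [pi_append, h1, pow_succ],
        by rw [run_append, h2, hwd 1 H.one_mem _ _ (nil_hfree hn0)]⟩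
  have hnfz : ∀ m W, nf (z ^ m * pi H W) = run H (m, []) W := by
    intro m W
    obtain ⟨Z, h1, h2⟩ := hzp m
    rw [← h1, ← pi_append, hnf_pi, run_append, h2]
  have hzpc : ∀ m W, pi H W * z ^ m = z ^ m * pi H W := by
    intro m W
    exact ((show Commute z (pi H W) from hzc W).pow_left m).eq.symm
  have hprod : ∀ s t W, nf (s * pi H W * t) =
      run H ((nf s).1 + (nf t).1, []) ((nf s).2 ++ W ++ (nf t).2) := by
    intro s t W
    rw [← hnfz]
    congr 1
    conv_lhs => rw [← hval s, ← hval t]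
    simp only [val]
    rw [pi_append, pi_append, pow_add]
    have := hzpc (nf t).1 ((nf s).2 ++ W)
    rw [pi_append] at this
    calc z ^ (nf s).1 * pi H (nf s).2 * pi H W * (z ^ (nf t).1 * pi H (nf t).2)
        = z ^ (nf s).1 * ((pi H (nf s).2 * pi H W) * z ^ (nf t).1) * pi H (nf t).2 := by
          simp only [mul_assoc]
      _ = _ := by rw [this]; simp only [mul_assoc]
  let g : SnMonoid n ↑H → ℕ ×ₗ ℕ := fun s => toLex ((nf s).2.length, (nf s).1)
  have gle : ∀ s t, g s ≤ g t → (nf s).2.length ≤ (nf t).2.length ∧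
      ((nf s).2.length = (nf t).2.length → (nf s).1 ≤ (nf t).1) := by
    intro s t h
    rcases Prod.Lex.le_iff.1 h with h | ⟨h, h'⟩
    · replace h : (nf s).2.length < (nf t).2.length := h
      exact ⟨h.le, fun h' => by omega⟩
    · replace h : (nf s).2.length = (nf t).2.length := h
      exact ⟨h.le, fun _ => h'⟩
  apply crit (CC H)
  intro A B hA hB
  obtain ⟨s, hs, hsm⟩ := Finset.exists_max_image A g hA
  obtain ⟨t, ht, htm⟩ := Finset.exists_max_image B g hB
  obtain ⟨i, hi⟩ := free_dup_last hn _ (hfree s)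
  obtain ⟨f, hf⟩ := free_dup_first hn _ (hfree t)
  have hfr := free_sep hn hi hf
  have hnst : nf (s * pi H [i, i, f, f] * t) =
      ((nf s).1 + (nf t).1, (nf s).2 ++ [i, i, f, f] ++ (nf t).2) := by
    rw [hprod, run_free]
    · rfl
    · exact hfr
  have hlen : (nf (s * pi H [i, i, f, f] * t)).2.length =
      (nf s).2.length + 4 + (nf t).2.length := by
    rw [hnst]; simp; omega
  refine ⟨s, hs, pi H [i, i, f, f], mem_CC.2 ⟨i, f, rfl⟩, t, ht, ?_, ?_, ?_⟩
  · intro s' hs' c' hc' t' ht' he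
    obtain ⟨j, b, rfl⟩ := mem_CC.1 hc'
    have l1 := gle _ _ (hsm s' hs')
    have l2 := gle _ _ (htm t' ht')
    have h0 := congrArg nf he
    rw [hnst, hprod] at h0
    rcases run_len (H := H) hn0 ((nf s').2 ++ [j, j, b, b] ++ (nf t').2)
      ((nf s').1 + (nf t').1) [] with h | h
    · rw [h, Prod.mk.injEq] at h0
      obtain ⟨h1, h2⟩ := h0
      rw [List.nil_append] at h2
      have l5 := congrArg List.length h2
      simp only [List.length_append, List.length_cons, List.length_nil] at l5
      obtain ⟨e1, e2⟩ := List.append_inj h2 (by simp; omega)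
      obtain ⟨e3, e4⟩ := List.append_inj e1 (by omega)
      have l3 := l1.2 (by rw [e3])
      have l4 := l2.2 (by rw [e2])
      refine ⟨?_, by rw [e4], ?_⟩
      · rw [← hval s', ← hval s]
        congr 1
        exact Prod.ext (by omega) e3
      · rw [← hval t', ← hval t]
        congr 1
        exact Prod.ext (by omega) e2
    · rw [h0] at h
      simp at h
      omega
  · intro h
    have := (gle _ _ (hsm _ h)).1
    omega
  · intro h
    rw [h, ← pi_nil, hnf_pi] at hlen
    simp [run] at hlen
    omega

end cyc

end SnAux

theorem stmt16 (n : ℕ) (H : Subgroup (Equiv.Perm (Fin n)))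
    (hab : ∀ σ ∈ H, ∀ τ ∈ H, σ * τ = τ * σ)
    (K : Type) [Field K] :
    (⊥ : Ideal (MonoidAlgebra K (SnMonoid n ↑H))).jacobson = ⊥ := by
  rcases Nat.eq_zero_or_pos n with h0 | h0
  · exact SnAux.case0 K h0
  by_cases hg : SnAux.Good H 1
  · by_cases hn : 3 ≤ n
    · exact SnAux.caseC K hab hn hg
    · exact SnAux.caseB K h0 (by omega) hg
  · have hn2 : 2 ≤ n := by
      by_contra hn
      exact hg ⟨1, H.one_mem, fun a h => by omega⟩
    refine SnAux.caseD K hab hn2 hg ?_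
    by_cases hn : 3 ≤ n
    · exact Or.inl hn
    right
    obtain rfl : n = 2 := by omega
    intro σ hσ
    by_contra hne
    apply hg
    refine ⟨σ, hσ, fun a h => ?_⟩
    obtain rfl : a = 0 := by omega
    by_contra hc
    apply hne
    have h1 : σ 0 = 0 := by
      have : σ 0 ≠ 1 := hc
      omega
    have h2 : σ 1 = 1 := by
      have : σ 1 ≠ σ 0 := fun h => by simpa using σ.injective h
      rw [h1] at this
      omega
    ext x
    fin_cases x
    · simp [h1]
    · simp [h2]
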